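/- arXiv:1506.09142 — 2 statements merged into one kernel-verified Lean document; each statement's English description precedes it below -/
import Mathlib

section
/- The subgroup T_B = {g(u,Bu,I) : u ∈ K^n} is a normal subgroup of Γ if and only if M^δ B M^{-1} = B for every M ∈ Γ₀. -/
open Matrix

/-- The block matrix `g(u,v,M)` (with `Md = M^δ`): block rows `(1,0,0)`, `(u,M,0)`, `(v,0,Md)`. -/
def gmat {K : Type*} [Field K] {n : ℕ} (u v : Fin n → K)
    (M Md : Matrix (Fin n) (Fin n) K) :
    Matrix (Unit ⊕ Fin n ⊕ Fin n) (Unit ⊕ Fin n ⊕ Fin n) K :=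
  Matrix.fromBlocks 1 0 (Matrix.of fun i _ => Sum.elim u v i) (Matrix.fromBlocks M 0 0 Md)

/-- The underlying matrix of an element of a subgroup of `GL (Fin n) K`. -/
def mOf {K : Type*} [Field K] {n : ℕ} {Γ₀ : Subgroup (GL (Fin n) K)} (M : Γ₀) :
    Matrix (Fin n) (Fin n) K := ((M : GL (Fin n) K) : Matrix (Fin n) (Fin n) K)

section BlockMatrix

variable {K : Type*} [Field K] {n : ℕ}

theorem gmat_mul (u v u' v' : Fin n → K) (M Md M' Md' : Matrix (Fin n) (Fin n) K) :
    gmat u v M Md * gmat u' v' M' Md' =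
      gmat (u + M.mulVec u') (v + Md.mulVec v') (M * M') (Md * Md') := by
  unfold gmat
  rw [Matrix.fromBlocks_multiply]
  congr 1
  · simp
  · simp
  · ext i j
    rcases i with i | i <;> simp [Matrix.mul_apply, Matrix.mulVec, dotProduct]
  · simp [Matrix.fromBlocks_multiply]

theorem gmat_inj {u v u' v' : Fin n → K} {M Md M' Md' : Matrix (Fin n) (Fin n) K}
    (h : gmat u v M Md = gmat u' v' M' Md') : u = u' ∧ v = v' := by
  constructor
  · ext i
    exact congrFun (congrFun h (Sum.inr (Sum.inl i))) (Sum.inl ())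
  · ext i
    exact congrFun (congrFun h (Sum.inr (Sum.inr i))) (Sum.inl ())

theorem det_gmat (u v : Fin n → K) (M Md : Matrix (Fin n) (Fin n) K) :
    (gmat u v M Md).det = M.det * Md.det := by
  simp [gmat]

theorem gmat_conj (u v w z : Fin n → K) {M Md : Matrix (Fin n) (Fin n) K}
    (hM : IsUnit M.det) (hMd : IsUnit Md.det) :
    gmat u v M Md * gmat w z 1 1 * (gmat u v M Md)⁻¹ =
      gmat (M.mulVec w) (Md.mulVec z) 1 1 := by
  have hcomm : gmat u v M Md * gmat w z 1 1 =
      gmat (M.mulVec w) (Md.mulVec z) 1 1 * gmat u v M Md := by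
    simp [gmat_mul, add_comm]
  rw [hcomm, Matrix.mul_nonsing_inv_cancel_right]
  rw [det_gmat]
  exact hM.mul hMd

theorem isUnit_det_mOf {Γ₀ : Subgroup (GL (Fin n) K)} (M : Γ₀) : IsUnit (mOf M).det :=
  (Matrix.isUnit_iff_isUnit_det _).1 (M : GL (Fin n) K).isUnit

end BlockMatrix

theorem stmt4 (K : Type*) [Field K] (n : ℕ) (hn : 1 ≤ n)
    (Γ₀ : Subgroup (GL (Fin n) K)) (δ : Γ₀ →* Γ₀) (B : GL (Fin n) K) :
    -- T_B is a normal subgroup of Γ iff M^δ B M⁻¹ = B for all M ∈ Γ₀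
    (∀ γ ∈ {X | ∃ u v, ∃ M : Γ₀, X = gmat u v (mOf M) (mOf (δ M))},
        ∀ t ∈ {X | ∃ u : Fin n → K, X = gmat u ((B : Matrix (Fin n) (Fin n) K).mulVec u) 1 1},
          γ * t * γ⁻¹ ∈
            {X | ∃ u : Fin n → K, X = gmat u ((B : Matrix (Fin n) (Fin n) K).mulVec u) 1 1}) ↔
      (∀ M : Γ₀, mOf (δ M) * (B : Matrix (Fin n) (Fin n) K) * (mOf M)⁻¹ =
        (B : Matrix (Fin n) (Fin n) K)) := by
  have conj_mem_iff (u v w : Fin n → K) (M : Γ₀) :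
      (gmat u v (mOf M) (mOf (δ M)) *
          gmat w ((B : Matrix (Fin n) (Fin n) K).mulVec w) 1 1 *
          (gmat u v (mOf M) (mOf (δ M)))⁻¹ ∈
        {X | ∃ u : Fin n → K, X = gmat u ((B : Matrix (Fin n) (Fin n) K).mulVec u) 1 1}) ↔
      (mOf (δ M) * (B : Matrix (Fin n) (Fin n) K)).mulVec w =
        ((B : Matrix (Fin n) (Fin n) K) * mOf M).mulVec w := by
    rw [gmat_conj _ _ _ _ (isUnit_det_mOf M) (isUnit_det_mOf (δ M)),
      ← Matrix.mulVec_mulVec, ← Matrix.mulVec_mulVec]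
    constructor
    · rintro ⟨w', hw'⟩
      obtain ⟨rfl, h⟩ := gmat_inj hw'
      exact h
    · intro h
      exact ⟨_, by rw [h]⟩
  constructor
  · intro h M
    have hcomm : mOf (δ M) * (B : Matrix (Fin n) (Fin n) K) = B * mOf M :=
      Matrix.ext_of_mulVec_single fun i =>
        (conj_mem_iff 0 0 _ M).1 (h _ ⟨0, 0, M, rfl⟩ _ ⟨_, rfl⟩)
    rw [hcomm, Matrix.mul_nonsing_inv_cancel_right _ _ (isUnit_det_mOf M)]
  · rintro h _ ⟨u, v, M, rfl⟩ _ ⟨w, rfl⟩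
    rw [conj_mem_iff]
    nth_rewrite 2 [← h M]
    rw [Matrix.nonsing_inv_mul_cancel_right _ _ (isUnit_det_mOf M)]
end

section
/- Let Γ act on K^n × K^n by g(u,v,M)·(x,y) = (u + Mx, v + M^δ y), and let Q_A = {(x, Ax) : x ∈ K^n}. Then the setwise stabilizer of Q_A in Γ equals H = {g(u,Au,I) : u ∈ K^n} if and only if M^δ A ≠ A M for every M ∈ Γ₀ with M ≠ I. -/
open Matrix

/-- The point of the affine space `A_{2n}` with coordinates `(1, x, y)`. -/
def pvec {K : Type*} [Field K] {n : ℕ} (x y : Fin n → K) : (Unit ⊕ Fin n ⊕ Fin n) → K :=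
  Sum.elim (fun _ => (1 : K)) (Sum.elim x y)

theorem gmat_mulVec_pvec {K : Type*} [Field K] {n : ℕ} (u v x y : Fin n → K)
    (M Md : Matrix (Fin n) (Fin n) K) :
    (gmat u v M Md).mulVec (pvec x y) = pvec (u + M.mulVec x) (v + Md.mulVec y) := by
  ext (i | i | i) <;>
    simp [gmat, pvec, Matrix.mulVec, dotProduct, Fintype.sum_sum_type]

theorem pvec_inj {K : Type*} [Field K] {n : ℕ} {x y x' y' : Fin n → K} :
    pvec x y = pvec x' y' ↔ x = x' ∧ y = y' := by
  refine ⟨fun h => ⟨?_, ?_⟩, by rintro ⟨rfl, rfl⟩; rfl⟩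
  · funext i
    exact congrFun h (Sum.inr (Sum.inl i))
  · funext i
    exact congrFun h (Sum.inr (Sum.inr i))

theorem mOf_one {K : Type*} [Field K] {n : ℕ} {Γ₀ : Subgroup (GL (Fin n) K)} :
    mOf (1 : Γ₀) = 1 := rfl

theorem mOf_mul {K : Type*} [Field K] {n : ℕ} {Γ₀ : Subgroup (GL (Fin n) K)} (M N : Γ₀) :
    mOf (M * N) = mOf M * mOf N := rfl

theorem mOf_injective {K : Type*} [Field K] {n : ℕ} {Γ₀ : Subgroup (GL (Fin n) K)} :
    Function.Injective (mOf : Γ₀ → Matrix (Fin n) (Fin n) K) :=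
  fun _ _ h => Subtype.ext (Units.ext h)

theorem gmat_left_eq {K : Type*} [Field K] {n : ℕ} {u v u' v' : Fin n → K}
    {M Md M' Md' : Matrix (Fin n) (Fin n) K} (h : gmat u v M Md = gmat u' v' M' Md') :
    M = M' :=
  (Matrix.fromBlocks_inj.1 (Matrix.fromBlocks_inj.1 h).2.2.2).1

/-- The element `g(u,v,M)` stabilizes the graph of `A` iff `v = A u` and `M^δ A = A M`. -/
theorem gmat_image_graph_eq_iff {K : Type*} [Field K] {n : ℕ} {Γ₀ : Subgroup (GL (Fin n) K)}
    (A Md : Matrix (Fin n) (Fin n) K) (u v : Fin n → K) (M : Γ₀) :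
    (fun w => (gmat u v (mOf M) Md).mulVec w) '' {w | ∃ x : Fin n → K, w = pvec x (A.mulVec x)} =
        {w | ∃ x : Fin n → K, w = pvec x (A.mulVec x)} ↔
      v = A.mulVec u ∧ Md * A = A * mOf M := by
  constructor
  · intro h
    have key (x : Fin n → K) :
        v + Md.mulVec (A.mulVec x) = A.mulVec (u + (mOf M).mulVec x) := by
      obtain ⟨x', hx'⟩ := h.subset ⟨_, ⟨x, rfl⟩, rfl⟩
      obtain ⟨h₁, h₂⟩ := pvec_inj.1 ((gmat_mulVec_pvec ..).symm.trans hx')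
      rw [h₂, h₁]
    have hv : v = A.mulVec u := by simpa using key 0
    refine ⟨hv, Matrix.mulVec_injective (funext fun x => ?_)⟩
    have hx := key x
    rw [hv, Matrix.mulVec_add, add_right_inj] at hx
    simpa [Matrix.mulVec_mulVec] using hx
  · rintro ⟨rfl, hM⟩
    have key (x : Fin n → K) : (gmat u (A.mulVec u) (mOf M) Md).mulVec (pvec x (A.mulVec x)) =
        pvec (u + (mOf M).mulVec x) (A.mulVec (u + (mOf M).mulVec x)) := by
      rw [gmat_mulVec_pvec, Matrix.mulVec_add, Matrix.mulVec_mulVec, hM, Matrix.mulVec_mulVec]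
    apply Set.Subset.antisymm
    · rintro _ ⟨_, ⟨x, rfl⟩, rfl⟩
      exact ⟨_, key x⟩
    · rintro _ ⟨x, rfl⟩
      refine ⟨_, ⟨(mOf M⁻¹).mulVec (x - u), rfl⟩, (key _).trans ?_⟩
      rw [Matrix.mulVec_mulVec, ← mOf_mul, mul_inv_cancel, mOf_one, Matrix.one_mulVec,
        add_sub_cancel]

theorem stmt9 (K : Type*) [Field K] (n : ℕ) (hn : 1 ≤ n)
    (Γ₀ : Subgroup (GL (Fin n) K)) (δ : Γ₀ →* Γ₀) (A : GL (Fin n) K) :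
    -- Γ acts on points (1,x,y) by matrix-vector multiplication:
    -- g(u,v,M)·(1,x,y) = (1, u + Mx, v + M^δ y); Q_A = {(1,x,Ax)}
    let Γ : Set (Matrix (Unit ⊕ Fin n ⊕ Fin n) (Unit ⊕ Fin n ⊕ Fin n) K) :=
      {X | ∃ u v, ∃ M : Γ₀, X = gmat u v (mOf M) (mOf (δ M))}
    let H : Set (Matrix (Unit ⊕ Fin n ⊕ Fin n) (Unit ⊕ Fin n ⊕ Fin n) K) :=
      {X | ∃ u : Fin n → K, X = gmat u ((A : Matrix (Fin n) (Fin n) K).mulVec u) 1 1}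
    let QA : Set ((Unit ⊕ Fin n ⊕ Fin n) → K) :=
      {w | ∃ x : Fin n → K, w = pvec x ((A : Matrix (Fin n) (Fin n) K).mulVec x)}
    -- the setwise stabilizer of Q_A in Γ equals H iff M^δ A ≠ A M for all I ≠ M ∈ Γ₀
    {γ ∈ Γ | (fun w => γ.mulVec w) '' QA = QA} = H ↔
      ∀ M : Γ₀, M ≠ 1 →
        mOf (δ M) * (A : Matrix (Fin n) (Fin n) K) ≠
          (A : Matrix (Fin n) (Fin n) K) * mOf M := by
  intro Γ H QA
  constructor
  · intro h M hM hA
    have hmem : gmat 0 0 (mOf M) (mOf (δ M)) ∈ {γ ∈ Γ | (fun w => γ.mulVec w) '' QA = QA} :=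
      ⟨⟨0, 0, M, rfl⟩, (gmat_image_graph_eq_iff ..).2 ⟨by simp, hA⟩⟩
    rw [h] at hmem
    obtain ⟨u, hu⟩ := hmem
    exact hM (mOf_injective (gmat_left_eq hu))
  · intro h
    apply Set.Subset.antisymm
    · rintro _ ⟨⟨u, v, M, rfl⟩, hQ⟩
      obtain ⟨rfl, hA⟩ := (gmat_image_graph_eq_iff ..).1 hQ
      obtain rfl : M = 1 := by_contra fun hM => h M hM hA
      exact ⟨u, by rw [map_one, mOf_one]⟩
    · rintro _ ⟨u, rfl⟩
      exact ⟨⟨u, _, 1, by rw [map_one, mOf_one]⟩,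
        (gmat_image_graph_eq_iff (Γ₀ := Γ₀) _ 1 u _ 1).2 ⟨rfl, by rw [mOf_one, one_mul, mul_one]⟩⟩
end
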